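/- Let n ≥ 1 be an integer, let w ∈ 𝔻, let ψ₀ and ψₙ be analytic functions on 𝔻, and let φ₀ and φₙ be analytic self-maps of 𝔻 with φ₀(w) = w and φₙ(w) = w. Suppose ψₙ has a zero at w of order at least n. Let f be analytic on 𝔻, let 0 ≤ l < n be an integer, and suppose f⁽ʲ⁾(w) = 0 for all 0 ≤ j ≤ l−1. Then the l-th derivative of z ↦ ψ₀(z)·f(φ₀(z)) + ψₙ(z)·f⁽ⁿ⁾(φₙ(z)) at the point w equals ψ₀(w)·(φ₀′(w))^l·f⁽ˡ⁾(w). -/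

import Mathlib

open scoped Nat

/-- The `n`-th derivative at `w` of a function that agrees near `w` with `(z - w) ^ n * g z`,
`g` analytic at `w`, is `n ! * g w`. -/
theorem iteratedDeriv_eq_factorial_mul_of_eventuallyEq {w : ℂ} (n : ℕ) {F g : ℂ → ℂ}
    (hg : AnalyticAt ℂ g w) (hF : F =ᶠ[nhds w] fun z => (z - w) ^ n * g z) :
    iteratedDeriv n F w = n ! * g w := by
  induction n generalizing F g with
  | zero => simpa using hF.eq_of_nhds
  | succ n ih =>
    have hG : AnalyticAt ℂ (fun z => (n + 1) * g z + (z - w) * deriv g z) w := by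
      have := hg.deriv
      fun_prop
    rw [iteratedDeriv_succ', ih hG]
    · push_cast [Nat.factorial_succ]
      simp
      ring
    · filter_upwards [hF.deriv, hg.eventually_analyticAt] with z hz hgz
      have h := (((hasDerivAt_id z).sub_const w).pow (n + 1)).mul hgz.differentiableAt.hasDerivAt
      have h' : HasDerivAt (fun z => (z - w) ^ (n + 1) * g z) _ z := h
      rw [hz, h'.deriv]
      simp
      ring


/-- Step in Proposition 3: if `f` vanishes at `w` to order `l < n`, then the `l`-th
derivative of `z ↦ ψ₀ z * f (φ₀ z) + ψₙ z * f⁽ⁿ⁾ (φₙ z)` at `w` equals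
`ψ₀ w * (φ₀' w)^l * f⁽ˡ⁾ w`. -/
theorem stmt_4 (n l : ℕ) (hn : 1 ≤ n) (hl : l < n)
    (w : ℂ) (hw : w ∈ Metric.ball (0 : ℂ) 1)
    (ψ₀ ψₙ φ₀ φₙ : ℂ → ℂ)
    (hψ₀ : DifferentiableOn ℂ ψ₀ (Metric.ball 0 1))
    (hψₙ : DifferentiableOn ℂ ψₙ (Metric.ball 0 1))
    (hφ₀ : DifferentiableOn ℂ φ₀ (Metric.ball 0 1))
    (hφₙ : DifferentiableOn ℂ φₙ (Metric.ball 0 1))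
    (hφ₀m : Set.MapsTo φ₀ (Metric.ball 0 1) (Metric.ball 0 1))
    (hφₙm : Set.MapsTo φₙ (Metric.ball 0 1) (Metric.ball 0 1))
    (hfix₀ : φ₀ w = w) (hfixₙ : φₙ w = w)
    (hzero : ∀ k < n, iteratedDeriv k ψₙ w = 0)
    (f : ℂ → ℂ) (hf : DifferentiableOn ℂ f (Metric.ball 0 1))
    (hfzero : ∀ j < l, iteratedDeriv j f w = 0) :
    iteratedDeriv l (fun z => ψ₀ z * f (φ₀ z) + ψₙ z * iteratedDeriv n f (φₙ z)) w
      = ψ₀ w * (deriv φ₀ w) ^ l * iteratedDeriv l f w := by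
  have hmem : Metric.ball (0 : ℂ) 1 ∈ nhds w := Metric.isOpen_ball.mem_nhds hw
  have aψ₀ := hψ₀.analyticAt hmem
  have aψₙ := hψₙ.analyticAt hmem
  have aφ₀ := hφ₀.analyticAt hmem
  have aφₙ := hφₙ.analyticAt hmem
  have af := hf.analyticAt hmem
  obtain ⟨g, ag, hg⟩ := (natCast_le_analyticOrderAt af).1
    ((natCast_le_analyticOrderAt_iff_iteratedDeriv_eq_zero af).2 hfzero)
  obtain ⟨k, ak, hk⟩ := (natCast_le_analyticOrderAt aψₙ).1
    ((natCast_le_analyticOrderAt_iff_iteratedDeriv_eq_zero aψₙ).2 hzero)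
  have aφ₀w : AnalyticAt ℂ (fun z => φ₀ z - w) w := by fun_prop
  obtain ⟨h, ah, hh⟩ := (natCast_le_analyticOrderAt (n := 1) aφ₀w).1
    ((natCast_le_analyticOrderAt_iff_iteratedDeriv_eq_zero aφ₀w).2 (by simp [hfix₀]))
  simp only [smul_eq_mul] at hg hk hh
  have hderiv : deriv φ₀ w = h w := by
    simpa using iteratedDeriv_eq_factorial_mul_of_eventuallyEq 1 ah hh
  have ag' : AnalyticAt ℂ (fun z => g (φ₀ z)) w := by
    refine AnalyticAt.fun_comp ?_ aφ₀
    rwa [hfix₀]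
  have af' : AnalyticAt ℂ (fun z => iteratedDeriv n f (φₙ z)) w := by
    refine AnalyticAt.fun_comp ?_ aφₙ
    rw [hfixₙ, iteratedDeriv_eq_iterate]
    exact af.iterated_deriv n
  have htend : Filter.Tendsto φ₀ (nhds w) (nhds w) := by
    simpa only [hfix₀] using aφ₀.continuousAt.tendsto
  rw [iteratedDeriv_eq_factorial_mul_of_eventuallyEq l ag hg, hderiv,
    iteratedDeriv_eq_factorial_mul_of_eventuallyEq l
      (g := fun z => ψ₀ z * h z ^ l * g (φ₀ z)
        + (z - w) ^ (n - l) * k z * iteratedDeriv n f (φₙ z))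
      (((aψ₀.fun_mul (ah.fun_pow l)).fun_mul ag').fun_add
        (AnalyticAt.fun_mul (by fun_prop) af'))]
  · simp [hfix₀, Nat.sub_ne_zero_of_lt hl]
    ring
  · filter_upwards [htend.eventually hg, hk, hh] with z hgz hkz hhz
    rw [hgz, hkz, hhz, pow_one, mul_pow, ← pow_mul_pow_sub (z - w) hl.le]
    ring
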